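/- arXiv:math/0105108 — 2 statements merged into one kernel-verified Lean document; each statement's English description precedes it below -/
import Mathlib

section
/- If a projective plane curve of degree 5 has six singular points lying on a nondegenerate (smooth) conic, then the curve contains that conic, i.e., the defining quadratic form divides the quintic. -/
/-- `f` is singular at the point of `ℂP²` represented by the nonzero vector `v`:
all partial derivatives vanish at `v`. -/
def SingularAt (f : MvPolynomial (Fin 3) ℂ) (v : Fin 3 → ℂ) : Prop :=
  ∀ j : Fin 3, MvPolynomial.eval v (MvPolynomial.pderiv j f) = 0

namespace MvPolynomial

/-- Over an algebraically closed field, an irreducible polynomial divides every polynomial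
vanishing on its zero set. -/
theorem _root_.Irreducible.dvd_of_forall_eval_eq_zero {σ k : Type*} [Finite σ] [Field k]
    [IsAlgClosed k] {p g : MvPolynomial σ k} (hp : Irreducible p)
    (h : ∀ x, eval x p = 0 → eval x g = 0) : p ∣ g := by
  have : (Ideal.span {p}).IsPrime := (Ideal.span_singleton_prime hp.ne_zero).2 hp.prime
  rw [← Ideal.mem_span_singleton, ← IsPrime.vanishingIdeal_zeroLocus (K := k) (Ideal.span {p}),
    mem_vanishingIdeal_iff]
  intro x hx
  have := hx p (Ideal.mem_span_singleton_self p)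
  simp only [aeval_eq_eval] at this ⊢
  exact h x this

/-- The chain rule for substituting univariate polynomials. -/
theorem derivative_aeval {σ k : Type*} [Fintype σ] [CommRing k] (φ : σ → Polynomial k)
    (f : MvPolynomial σ k) :
    Polynomial.derivative (MvPolynomial.aeval φ f) =
      ∑ j, aeval φ (pderiv j f) * Polynomial.derivative (φ j) := by
  classical
  induction f using MvPolynomial.induction_on with
  | C a => simp
  | add p q hp hq => simp [hp, hq, add_mul, Finset.sum_add_distrib]
  | mul_X p i hp =>
    simp only [map_mul, aeval_X, Polynomial.derivative_mul, hp, pderiv_mul, pderiv_X, map_add,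
      add_mul, Finset.sum_add_distrib, Finset.sum_mul]
    refine congrArg₂ (· + ·) ?_ ?_
    · exact Finset.sum_congr rfl fun j _ => mul_right_comm _ _ _
    · rw [Finset.sum_eq_single i]
      · simp
      · intro j _ hj
        simp [Pi.single_eq_of_ne hj.symm]
      · simp

theorem IsHomogeneous.natDegree_aeval_le {σ k : Type*} [Fintype σ] [CommRing k]
    {f : MvPolynomial σ k} {n m : ℕ} (hf : f.IsHomogeneous n) {φ : σ → Polynomial k}
    (hφ : ∀ i, (φ i).natDegree ≤ m) : (MvPolynomial.aeval φ f).natDegree ≤ n * m := by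
  rw [MvPolynomial.aeval_def, MvPolynomial.eval₂_eq']
  refine Polynomial.natDegree_sum_le_of_forall_le _ _ fun d hd => ?_
  rw [← Polynomial.C_eq_algebraMap]
  refine (Polynomial.natDegree_C_mul_le _ _).trans ((Polynomial.natDegree_prod_le _ _).trans ?_)
  have hn := hf.degree_eq_sum_deg_support hd
  calc ∑ i, (φ i ^ d i).natDegree ≤ ∑ i, d i * m :=
        Finset.sum_le_sum fun i _ => Polynomial.natDegree_pow_le_of_le _ (hφ i)
    _ = n * m := by
        rw [← Finset.sum_mul, hn]
        congr 1
        exact (Finset.sum_subset (Finset.subset_univ _) (by simp)).symm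

theorem IsHomogeneous.coeff_aeval {k : Type*} [CommRing k]
    {f : MvPolynomial (Fin 3) k} {n m : ℕ} (hf : f.IsHomogeneous n) {φ : Fin 3 → Polynomial k}
    (hφ : ∀ i, (φ i).natDegree ≤ m) :
    (MvPolynomial.aeval φ f).coeff (n * m) = eval (fun i => (φ i).coeff m) f := by
  rw [MvPolynomial.aeval_def, MvPolynomial.eval₂_eq', eval_eq', Polynomial.finsetSum_coeff]
  refine Finset.sum_congr rfl fun d hd => ?_
  have hn : n = d 0 + d 1 + d 2 := by
    rw [hf.degree_eq_sum_deg_support hd, ← Fin.sum_univ_three]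
    exact Finset.sum_subset (Finset.subset_univ _) (by simp)
  have hp i : (φ i ^ d i).natDegree ≤ d i * m := Polynomial.natDegree_pow_le_of_le _ (hφ i)
  rw [← Polynomial.C_eq_algebraMap, Polynomial.coeff_C_mul, Fin.prod_univ_three,
    Fin.prod_univ_three, hn, add_mul, add_mul,
    Polynomial.coeff_mul_add_eq_of_natDegree_le (Polynomial.natDegree_mul_le_of_le (hp 0) (hp 1)) (hp 2),
    Polynomial.coeff_mul_add_eq_of_natDegree_le (hp 0) (hp 1)]
  simp only [Polynomial.coeff_pow_of_natDegree_le (hφ _)]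

theorem IsHomogeneous.eval_smul {σ k : Type*} [CommRing k]
    {f : MvPolynomial σ k} {n : ℕ} (hf : f.IsHomogeneous n) (c : k) (x : σ → k) :
    eval (c • x) f = c ^ n * eval x f := by
  rw [eval_eq, eval_eq, Finset.mul_sum]
  refine Finset.sum_congr rfl fun d hd => ?_
  simp only [Pi.smul_apply, smul_eq_mul, mul_pow, Finset.prod_mul_distrib, Finset.prod_pow_eq_pow_sum,
    ← hf.degree_eq_sum_deg_support hd]
  ring

theorem IsHomogeneous.exists_two_mul_eval_eq {σ k : Type*} [Fintype σ] [CommRing k]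
    {q : MvPolynomial σ k} (hq : q.IsHomogeneous 2) :
    ∃ M : σ → σ → k, ∀ x, 2 * eval x q = ∑ i, ∑ j, x i * (x j * M i j) := by
  refine ⟨fun i j => coeff 0 (pderiv j (pderiv i q)), fun x => ?_⟩
  have h2 : ∑ i, x i * eval x (pderiv i q) = 2 * eval x q := by
    simpa using congrArg (eval x) hq.sum_X_mul_pderiv
  have h1 i : ∑ j, x j * eval x (pderiv j (pderiv i q)) = eval x (pderiv i q) := by
    simpa using congrArg (eval x) (hq.pderiv (i := i)).sum_X_mul_pderiv
  have h0 i j : eval x (pderiv j (pderiv i q)) = coeff 0 (pderiv j (pderiv i q)) := by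
    have h := (hq.pderiv (i := i)).pderiv (i := j)
    rw [totalDegree_eq_zero_iff_eq_C.1 (Nat.le_zero.1 h.totalDegree_le)]
    simp
  simp only [← h2, ← h1, h0, Finset.mul_sum]

/-- Expansion of a ternary quadratic form along three vectors. -/
theorem IsHomogeneous.eval_quadratic_combination {q : MvPolynomial (Fin 3) ℂ}
    (hq : q.IsHomogeneous 2) (a b c : Fin 3 → ℂ) (x y z : ℂ) :
    eval (x • a + y • b + z • c) q =
      x ^ 2 * eval a q + y ^ 2 * eval b q + z ^ 2 * eval c q
        + x * y * QuadraticMap.polar (fun v => eval v q) a b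
        + x * z * QuadraticMap.polar (fun v => eval v q) a c
        + y * z * QuadraticMap.polar (fun v => eval v q) b c := by
  obtain ⟨M, hM⟩ := hq.exists_two_mul_eval_eq
  have hM' v : eval v q = (∑ i, ∑ j, v i * (v j * M i j)) / 2 := by
    rw [← hM]; ring
  simp only [QuadraticMap.polar, hM', Fin.sum_univ_three, Pi.add_apply, Pi.smul_apply, smul_eq_mul]
  ring

/-- An irreducible ternary quadratic form does not vanish identically on a line. -/
theorem not_forall_eval_pair_eq_zero {q : MvPolynomial (Fin 3) ℂ}
    (hq : q.IsHomogeneous 2) (hqirr : Irreducible q) {a b : Fin 3 → ℂ}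
    (hab : LinearIndependent ℂ ![a, b]) : ¬ ∀ x y : ℂ, eval (x • a + y • b) q = 0 := by
  intro h
  set n := crossProduct a b with hn
  have hn0 : n ≠ 0 := crossProduct_ne_zero_iff_linearIndependent.2 hab
  set l : MvPolynomial (Fin 3) ℂ := ∑ i, C (n i) * X i with hl
  have hl1 : l.IsHomogeneous 1 := IsHomogeneous.sum _ _ _ fun i _ => isHomogeneous_C_mul_X _ _
  have hl0 : l ≠ 0 := by
    intro h0
    apply hn0
    funext i
    have := congrArg (eval (Pi.single i 1)) h0
    simpa [hl, Pi.single_apply] using this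
  have hlirr : Irreducible l := by
    refine irreducible_of_totalDegree_eq_one (hl1.totalDegree hl0) fun x hx => ?_
    obtain ⟨i, hi⟩ : ∃ d, coeff d l ≠ 0 := by
      by_contra! h0
      exact hl0 (MvPolynomial.ext _ _ (by simpa using h0))
    exact isUnit_iff_ne_zero.2 fun hx0 => hi (by simpa [hx0] using hx i)
  have hdvd : l ∣ q := by
    refine hlirr.dvd_of_forall_eval_eq_zero fun v hv => ?_
    have hdet : Matrix.det ![v, a, b] = 0 := by
      rw [← triple_product_eq_det, ← hn, ← hv, hl]
      simp [dotProduct, mul_comm]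
    have hdep : ¬ LinearIndependent ℂ ![v, a, b] := fun hli => by
      have := (Matrix.isUnit_iff_isUnit_det _).1
        ((Matrix.linearIndependent_rows_iff_isUnit (A := ![v, a, b])).1 hli)
      simp [hdet] at this
    have hmem : v ∈ Submodule.span ℂ (Set.range ![a, b]) := by
      by_contra hmem
      exact hdep (linearIndependent_finCons.2 ⟨hab, hmem⟩)
    rw [Matrix.range_cons, Matrix.range_cons, Matrix.range_empty, Set.union_empty,
      Set.singleton_union, Submodule.mem_span_pair] at hmem
    obtain ⟨x, y, rfl⟩ := hmem
    exact h x y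
  have := totalDegree_le_of_dvd_of_isDomain (hlirr.dvd_symm hqirr hdvd) hl0
  rw [hl1.totalDegree hl0, hq.totalDegree hqirr.ne_zero] at this
  omega

/-- Two distinct points of an irreducible conic are not conjugate with respect to it. -/
theorem polar_ne_zero_of_linearIndependent {q : MvPolynomial (Fin 3) ℂ}
    (hq : q.IsHomogeneous 2) (hqirr : Irreducible q) {a b : Fin 3 → ℂ}
    (hab : LinearIndependent ℂ ![a, b]) (ha : eval a q = 0) (hb : eval b q = 0) :
    QuadraticMap.polar (fun v => eval v q) a b ≠ 0 := by
  intro h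
  refine not_forall_eval_pair_eq_zero hq hqirr hab fun x y => ?_
  simpa [ha, hb, h] using hq.eval_quadratic_combination a b 0 x y 0

/-- An irreducible conic has a quadratic parametrization sending `∞` to the point `w` and reaching
every other point at a finite parameter. -/
theorem exists_quadratic_parametrization {q : MvPolynomial (Fin 3) ℂ}
    (hq : q.IsHomogeneous 2) (hqirr : Irreducible q) {a w c : Fin 3 → ℂ}
    (haw : LinearIndependent ℂ ![a, w]) (hac : LinearIndependent ℂ ![a, c])
    (hwc : LinearIndependent ℂ ![w, c])
    (ha : eval a q = 0) (hw : eval w q = 0) (hc : eval c q = 0) :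
    ∃ φ : Fin 3 → Polynomial ℂ, (∀ i, (φ i).natDegree ≤ 2) ∧
      (∃ ν : ℂ, ν ≠ 0 ∧ (fun i => (φ i).coeff 2) = ν • w) ∧
      ∀ p, eval p q = 0 → (∀ y : ℂ, p ≠ y • w) →
        ∃ t r : ℂ, r ≠ 0 ∧ (fun i => (φ i).eval t) = r • p := by
  have hν := polar_ne_zero_of_linearIndependent hq hqirr haw ha hw
  have hμ := polar_ne_zero_of_linearIndependent hq hqirr hac ha hc
  have hl := polar_ne_zero_of_linearIndependent hq hqirr hwc hw hc
  have hexp := hq.eval_quadratic_combination a w c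
  simp only [ha, hw, hc, mul_zero, add_zero, zero_add] at hexp
  set ν := QuadraticMap.polar (fun v => eval v q) a w
  set μ := QuadraticMap.polar (fun v => eval v q) a c
  set l := QuadraticMap.polar (fun v => eval v q) w c
  have hspan : ∀ p : Fin 3 → ℂ, ∃ x y z : ℂ, p = x • a + y • w + z • c := by
    have hli : LinearIndependent ℂ ![c, a, w] := by
      refine linearIndependent_finCons.2 ⟨haw, fun hmem => ?_⟩
      rw [Matrix.range_cons, Matrix.range_cons, Matrix.range_empty, Set.union_empty,
        Set.singleton_union, Submodule.mem_span_pair] at hmem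
      obtain ⟨x, y, hxy⟩ := hmem
      have h := hexp x y 0
      simp only [zero_smul, add_zero, hxy, hc, mul_zero, zero_mul] at h
      have h' : x = 0 ∨ y = 0 := by simpa [hν] using h.symm
      rcases h' with rfl | rfl
      · exact one_ne_zero
          (LinearIndependent.pair_iff.1 hwc y (-1) (by rw [← hxy]; module) |>.2 |> neg_eq_zero.1)
      · exact one_ne_zero
          (LinearIndependent.pair_iff.1 hac x (-1) (by rw [← hxy]; module) |>.2 |> neg_eq_zero.1)
    intro p
    have hp : p ∈ Submodule.span ℂ (Set.range ![c, a, w]) := by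
      rw [hli.span_eq_top_of_card_eq_finrank' (by simp)]
      trivial
    obtain ⟨g, hg⟩ := (Submodule.mem_span_range_iff_exists_fun ℂ).1 hp
    refine ⟨g 1, g 2, g 0, ?_⟩
    rw [← hg, Fin.sum_univ_three]
    simp only [Matrix.cons_val]
    abel
  refine ⟨fun i => Polynomial.C (ν * w i) * Polynomial.X ^ 2
    + Polynomial.C (-l * a i + μ * w i + ν * c i) * Polynomial.X + Polynomial.C (μ * c i),
    fun i => Polynomial.natDegree_quadratic_le, ⟨ν, hν, ?_⟩, fun p hp hpw => ?_⟩
  · funext i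
    simp only [Polynomial.coeff_add, Polynomial.coeff_C_mul, Polynomial.coeff_X_pow,
      Polynomial.coeff_X, Polynomial.coeff_C]
    simp
  · obtain ⟨x, y, z, rfl⟩ := hspan p
    rw [hexp] at hp
    by_cases hz : z = 0
    · subst hz
      have hx : x ≠ 0 := by
        rintro rfl
        exact hpw y (by module)
      have hy : y = 0 := by simpa [hν, hx] using hp
      subst hy
      refine ⟨-μ / ν, l * μ / ν / x, by positivity, ?_⟩
      funext i
      simp
      field_simp
      ring
    · have hs : μ * z + ν * y ≠ 0 := by
        intro h0
        have h1 : l * (y * z) = 0 := by linear_combination hp - x * h0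
        have hy : y = 0 := by simpa [hl, hz] using h1
        subst hy
        simp [hμ, hz] at h0
      refine ⟨y / z, (μ * z + ν * y) / z ^ 2, div_ne_zero hs (pow_ne_zero _ hz), ?_⟩
      funext i
      simp
      field_simp
      linear_combination (-a i) * hp

end MvPolynomial

/-- A polynomial with more double roots than half its degree allows is zero. -/
theorem Polynomial.eq_zero_of_double_roots {k ι : Type*} [Field k] [Fintype ι] {F : Polynomial k}
    {t : ι → k} (ht : Function.Injective t) (h0 : ∀ i, F.eval (t i) = 0)
    (h1 : ∀ i, (derivative F).eval (t i) = 0) (hdeg : F.natDegree < 2 * Fintype.card ι) :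
    F = 0 := by
  by_contra hF
  have hdvd : ∏ i, (X - C (t i)) ^ 2 ∣ F := by
    refine Fintype.prod_dvd_of_coprime (fun i j hij => ?_) fun i => ?_
    · exact (pairwise_coprime_X_sub_C ht hij).pow
    · exact (le_rootMultiplicity_iff hF).1
        ((one_lt_rootMultiplicity_iff_isRoot hF).2 ⟨h0 i, h1 i⟩)
  have := natDegree_le_of_dvd hdvd hF
  rw [natDegree_prod_of_monic _ _ fun i _ => (monic_X_sub_C _).pow 2] at this
  simp at this
  omega

/-- If a plane curve of degree 5 has six singular points lying on a nondegenerate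
(irreducible) conic, then the defining quadratic form divides the quintic. -/
theorem stmt_10 (f q : MvPolynomial (Fin 3) ℂ)
    (hf0 : f ≠ 0) (hf : f.IsHomogeneous 5)
    (hq : q.IsHomogeneous 2) (hqirr : Irreducible q)
    (v : Fin 6 → (Fin 3 → ℂ)) (hv0 : ∀ i, v i ≠ 0)
    (hdist : ∀ i j, i ≠ j → ∀ c : ℂ, v i ≠ c • v j)
    (honconic : ∀ i, MvPolynomial.eval (v i) q = 0)
    (hsing : ∀ i, SingularAt f (v i)) :
    q ∣ f := by
  have hind {x y : Fin 3 → ℂ} (hx : x ≠ 0) (h : ∀ c : ℂ, y ≠ c • x) :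
      LinearIndependent ℂ ![x, y] :=
    (LinearIndependent.pair_iff' hx).2 fun c hc => h c hc.symm
  have hfv i : MvPolynomial.eval (v i) f = 0 := by
    have := congrArg (MvPolynomial.eval (v i)) hf.sum_X_mul_pderiv
    simpa [hsing i _] using this
  refine hqirr.dvd_of_forall_eval_eq_zero fun w hw => ?_
  by_cases hwv : ∃ i, ∃ c : ℂ, w = c • v i
  · obtain ⟨i, c, rfl⟩ := hwv
    rw [hf.eval_smul, hfv, mul_zero]
  push Not at hwv
  have hw0 : w ≠ 0 := fun h => hwv 0 0 (by simp [h])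
  have hvw i (y : ℂ) : v i ≠ y • w := by
    intro h
    have hy : y ≠ 0 := by
      rintro rfl
      exact hv0 i (by simpa using h)
    exact hwv i y⁻¹ (by rw [h, inv_smul_smul₀ hy])
  obtain ⟨φ, hφ, ⟨ν, hν, hlead⟩, hpar⟩ := MvPolynomial.exists_quadratic_parametrization hq hqirr
    (hind (hv0 0) (hwv 0)) (hind (hv0 0) (hdist 1 0 (by decide))) (hind hw0 (hvw 1))
    (honconic 0) hw (honconic 1)
  choose t r hr ht using fun i => hpar (v i) (honconic i) (hvw i)
  have htinj : Function.Injective t := by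
    intro i j hij
    by_contra hne
    refine hdist i j hne ((r i)⁻¹ * r j) ?_
    rw [mul_smul, ← ht j, ← hij, ht i, inv_smul_smul₀ (hr i)]
  have heval (g : MvPolynomial (Fin 3) ℂ) (s : ℂ) :
      (MvPolynomial.aeval φ g).eval s = MvPolynomial.eval (fun i => (φ i).eval s) g := by
    rw [← Polynomial.coe_evalRingHom, MvPolynomial.aeval_def, MvPolynomial.hom_eval₂]
    simp only [Polynomial.coe_evalRingHom, MvPolynomial.eval]
    congr 1
    ext
    simp
  have hF : MvPolynomial.aeval φ f = 0 := by
    refine Polynomial.eq_zero_of_double_roots htinj (fun i => ?_) (fun i => ?_) ?_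
    · rw [heval, ht, hf.eval_smul, hfv, mul_zero]
    · rw [MvPolynomial.derivative_aeval, Polynomial.eval_finsetSum]
      refine Finset.sum_eq_zero fun j _ => ?_
      rw [Polynomial.eval_mul, heval, ht, hf.pderiv.eval_smul, hsing i j, mul_zero, zero_mul]
    · have := hf.natDegree_aeval_le hφ
      simp only [Fintype.card_fin]
      omega
  have h := hf.coeff_aeval hφ
  rw [hF, hlead, hf.eval_smul, Polynomial.coeff_zero] at h
  simpa [hν] using h.symm
end

section
/- Let l₁, l₂ be two distinct lines in ℂP², let x₁,x₂,x₃ ∈ l₁ \ l₂, y₁,y₂,y₃ ∈ l₂ \ l₁ be distinct points, and let A ∉ l₁ ∪ l₂. Then there exists, up to nonzero scalar, exactly one cubic curve passing through all six points x_i, y_j and having a singular point at A. -/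
open MvPolynomial

/-- Linear induction on homogeneous polynomials from monomials. -/
@[elab_as_elim]
theorem MvPolynomial.IsHomogeneous.induction_monomial {σ R : Type*} [CommSemiring R] {n : ℕ}
    {p : MvPolynomial σ R → Prop} {f : MvPolynomial σ R} (hf : f.IsHomogeneous n) (zero : p 0)
    (add : ∀ f g, p f → p g → p (f + g))
    (monomial : ∀ (d : σ →₀ ℕ) (r : R), d.degree = n → p (MvPolynomial.monomial d r)) : p f := by
  rw [← f.support_sum_monomial_coeff]
  refine Finset.sum_induction _ p add zero fun d hd => monomial d _ ?_
  exact (hf.degree_eq_sum_deg_support hd).symm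

/-- The value of a ternary linear form is a dot product. -/
theorem exists_eval_eq_dotProduct {g : MvPolynomial (Fin 3) ℂ} (hg : g.IsHomogeneous 1) :
    ∃ p : Fin 3 → ℂ, ∀ v, eval v g = p 0 * v 0 + p 1 * v 1 + p 2 * v 2 := by
  refine hg.induction_monomial ?_ ?_ ?_
  · exact ⟨0, by simp⟩
  · rintro f g ⟨p, hp⟩ ⟨q, hq⟩
    exact ⟨p + q, fun v => by simp [hp, hq]; ring⟩
  · intro d r hd
    obtain ⟨i, rfl⟩ : d ∈ Set.range fun i => Finsupp.single i 1 := by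
      rwa [Finsupp.range_single_one]
    refine ⟨Pi.single i r, fun v => ?_⟩
    fin_cases i <;> simp [eval_monomial]

/-- The restriction of a ternary cubic to the line spanned by `u` and `v`. -/
theorem eval_cubic_line {f : MvPolynomial (Fin 3) ℂ} (hf : f.IsHomogeneous 3)
    (u v : Fin 3 → ℂ) (s t : ℂ) :
    eval (s • u + t • v) f = s ^ 3 * eval u f + s ^ 2 * t * ∑ j, v j * eval u (pderiv j f) +
      s * t ^ 2 * ∑ j, u j * eval v (pderiv j f) + t ^ 3 * eval v f := by
  refine hf.induction_monomial ?_ ?_ ?_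
  · simp
  · intro f g hf hg
    simp only [Fin.sum_univ_three, map_add] at *
    rw [hf, hg]
    ring
  · intro d r hd
    have hd' : d 0 + d 1 + d 2 = 3 := by
      rw [← Fin.sum_univ_three, ← Finsupp.degree_eq_sum, hd]
    simp only [pderiv_monomial, eval_monomial, Finsupp.prod_fintype, Fin.sum_univ_three,
      Fin.prod_univ_three, pow_zero, implies_true, Pi.add_apply, Pi.smul_apply, smul_eq_mul,
      Finsupp.tsub_apply, Finsupp.single_apply]
    simp only [Fin.isValue, reduceIte, Fin.reduceEq, tsub_zero]
    generalize d 0 = a at *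
    generalize d 1 = b at *
    generalize d 2 = c at *
    have ha : a ≤ 3 := by omega
    have hb : b ≤ 3 := by omega
    obtain rfl : c = 3 - a - b := by omega
    interval_cases a <;> interval_cases b <;> first | omega | (norm_num; ring)

/-- A cubic vanishing at `P` and three other points of a line vanishes on that line. -/
theorem cubic_eq_zero_on_line {f g h : MvPolynomial (Fin 3) ℂ} (hf : f.IsHomogeneous 3)
    (hg : g.IsHomogeneous 1) (hh : h.IsHomogeneous 1) {P : Fin 3 → ℂ}
    (hP : ∀ z, eval z g = 0 → eval z h = 0 → ∃ c : ℂ, z = c • P) (hfP : eval P f = 0)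
    (x : Fin 3 → (Fin 3 → ℂ)) (hx : ∀ i j, i ≠ j → ∀ c : ℂ, x i ≠ c • x j)
    (hxon : ∀ i, eval (x i) g = 0 ∧ eval (x i) h ≠ 0) (hfx : ∀ i, eval (x i) f = 0)
    {z : Fin 3 → ℂ} (hz : eval z g = 0) : eval z f = 0 := by
  have key : ∀ z, eval z g = 0 → ∃ t : ℂ, z = (eval z h / eval (x 0) h) • x 0 + t • P := by
    intro z hz
    obtain ⟨p, hp⟩ := exists_eval_eq_dotProduct hg
    obtain ⟨q, hq⟩ := exists_eval_eq_dotProduct hh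
    have h0 := (hxon 0).2
    obtain ⟨c, hc⟩ := hP (z - (eval z h / eval (x 0) h) • x 0)
      (by
        have h1 := (hxon 0).1
        rw [hp] at h1 hz ⊢
        simp only [Pi.sub_apply, Pi.smul_apply, smul_eq_mul]
        linear_combination hz - (eval z h / eval (x 0) h) * h1)
      (by
        have h1 := div_mul_cancel₀ (eval z h) h0
        rw [hq (z - _)]
        simp only [Pi.sub_apply, Pi.smul_apply, smul_eq_mul]
        linear_combination -h1 - hq z + (eval z h / eval (x 0) h) * hq (x 0))
    exact ⟨c, by rw [← hc]; abel⟩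
  have line := eval_cubic_line hf (x 0) P
  simp only [hfx, hfP, mul_zero, zero_add, add_zero] at line
  generalize (∑ j, P j * eval (x 0) (pderiv j f)) = A at line
  generalize (∑ j, x 0 j * eval P (pderiv j f)) = B at line
  obtain ⟨t₁, h₁⟩ := key (x 1) (hxon 1).1
  obtain ⟨t₂, h₂⟩ := key (x 2) (hxon 2).1
  obtain ⟨t, ht⟩ := key z hz
  have hs₁ : eval (x 1) h / eval (x 0) h ≠ 0 := div_ne_zero (hxon 1).2 (hxon 0).2
  have hs₂ : eval (x 2) h / eval (x 0) h ≠ 0 := div_ne_zero (hxon 2).2 (hxon 0).2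
  generalize eval (x 1) h / eval (x 0) h = s₁ at *
  generalize eval (x 2) h / eval (x 0) h = s₂ at *
  have ht₁ : t₁ ≠ 0 := by
    rintro rfl
    exact hx 1 0 (by decide) s₁ (by simpa using h₁)
  have ht₂ : t₂ ≠ 0 := by
    rintro rfl
    exact hx 2 0 (by decide) s₂ (by simpa using h₂)
  have hdet : s₁ * t₂ - s₂ * t₁ ≠ 0 := by
    intro h0
    refine hx 1 2 (by decide) (s₁ / s₂) ?_
    have h₃ : t₁ = s₁ / s₂ * t₂ := by
      field_simp
      linear_combination -h0
    rw [h₁, h₂, smul_add, smul_smul, smul_smul, div_mul_cancel₀ _ hs₂, ← h₃]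
  have e₁ : s₁ * A + t₁ * B = 0 := by
    have := line s₁ t₁
    rw [← h₁, hfx] at this
    refine (mul_eq_zero.1 (?_ : (s₁ * t₁) * (s₁ * A + t₁ * B) = 0)).resolve_left
      (mul_ne_zero hs₁ ht₁)
    linear_combination -this
  have e₂ : s₂ * A + t₂ * B = 0 := by
    have := line s₂ t₂
    rw [← h₂, hfx] at this
    refine (mul_eq_zero.1 (?_ : (s₂ * t₂) * (s₂ * A + t₂ * B) = 0)).resolve_left
      (mul_ne_zero hs₂ ht₂)
    linear_combination -this
  have hA : A = 0 := (mul_eq_zero.1 (by linear_combination t₂ * e₁ - t₁ * e₂ :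
    (s₁ * t₂ - s₂ * t₁) * A = 0)).resolve_left hdet
  have hB : B = 0 := (mul_eq_zero.1 (by linear_combination s₁ * e₂ - s₂ * e₁ :
    (s₁ * t₂ - s₂ * t₁) * B = 0)).resolve_left hdet
  rw [ht, line, hA, hB]
  ring

/-- A cubic vanishing on two lines and singular at a point off both of them is zero. -/
theorem cubic_eq_zero_of_singularAt {f g h : MvPolynomial (Fin 3) ℂ} (hf : f.IsHomogeneous 3)
    (hg : g.IsHomogeneous 1) (hh : h.IsHomogeneous 1) (hlines : ∀ c : ℂ, h ≠ c • g)
    {a : Fin 3 → ℂ} (hag : eval a g ≠ 0) (hah : eval a h ≠ 0) (hfa : SingularAt f a)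
    (hfg : ∀ z, eval z g = 0 → eval z f = 0) (hfh : ∀ z, eval z h = 0 → eval z f = 0) :
    f = 0 := by
  have hm : (eval a g • h - eval a h • g) * f = 0 := by
    refine MvPolynomial.funext fun z => ?_
    simp only [map_mul, map_sub, smul_eval, map_zero]
    by_contra hne
    obtain ⟨hdet, hfz⟩ := mul_ne_zero_iff.1 hne
    have hfa0 : eval a f = 0 := by
      have h₃ := eval_cubic_line hf a a 1 0
      have h₄ := eval_cubic_line hf a a 2 (-1)
      simp only [hfa _, mul_zero, Finset.sum_const_zero] at h₃ h₄
      have e : (2 : ℂ) • a + (-1 : ℂ) • a = (1 : ℂ) • a + (0 : ℂ) • a := by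
        rw [← add_smul, ← add_smul]; norm_num
      rw [e] at h₄
      linear_combination (h₃ - h₄) / 6
    have line := eval_cubic_line hf a z
    simp only [hfa _, hfa0, mul_zero, Finset.sum_const_zero, zero_add] at line
    generalize (∑ j, a j * eval z (pderiv j f)) = A at line
    have hroot : ∀ l : MvPolynomial (Fin 3) ℂ, l.IsHomogeneous 1 → eval a l ≠ 0 →
        (∀ z, eval z l = 0 → eval z f = 0) → eval z l * A - eval a l * eval z f = 0 := by
      intro l hl hal hfl
      obtain ⟨r, hr⟩ := exists_eval_eq_dotProduct hl
      have h0 := hfl (eval z l • a + (-eval a l) • z) (by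
        rw [hr, hr z, hr a]
        simp only [Pi.add_apply, Pi.smul_apply, smul_eq_mul]
        ring)
      rw [line] at h0
      refine (mul_eq_zero.1 (?_ : eval a l ^ 2 * _ = 0)).resolve_left (pow_ne_zero 2 hal)
      linear_combination h0
    have e₁ := hroot g hg hag hfg
    have e₂ := hroot h hh hah hfh
    exact hne (by linear_combination eval z g * e₂ - eval z h * e₁)
  refine (mul_eq_zero.1 hm).resolve_left fun h0 => hlines (eval a h / eval a g) ?_
  rw [div_eq_inv_mul, mul_smul, ← sub_eq_zero.1 h0, inv_smul_smul₀ hag]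

/-- Two distinct lines meet in exactly one point. -/
theorem exists_intersection {g h : MvPolynomial (Fin 3) ℂ} (hg0 : g ≠ 0)
    (hg : g.IsHomogeneous 1) (hh : h.IsHomogeneous 1) (hlines : ∀ c : ℂ, h ≠ c • g) :
    ∃ P : Fin 3 → ℂ, P ≠ 0 ∧ eval P g = 0 ∧ eval P h = 0 ∧
      ∀ z, eval z g = 0 → eval z h = 0 → ∃ c : ℂ, z = c • P := by
  obtain ⟨p, hp⟩ := exists_eval_eq_dotProduct hg
  obtain ⟨q, hq⟩ := exists_eval_eq_dotProduct hh
  have hli : LinearIndependent ℂ ![p, q] := by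
    rw [LinearIndependent.pair_iff' ?_]
    · rintro c rfl
      refine hlines c (MvPolynomial.funext fun z => ?_)
      rw [smul_eval, hq, hp]
      simp only [Pi.smul_apply, smul_eq_mul]
      ring
    · rintro rfl
      exact hg0 (MvPolynomial.funext fun z => by simp [hp])
  have hP := crossProduct_ne_zero_iff_linearIndependent.2 hli
  refine ⟨crossProduct p q, hP, ?_, ?_, fun z hzg hzh => ?_⟩
  · rw [hp]; simp [cross_apply]; ring
  · rw [hq]; simp [cross_apply]; ring
  · have hz : crossProduct (crossProduct p q) z = 0 := by
      rw [hp] at hzg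
      rw [hq] at hzh
      rw [cross_cross_eq_smul_sub_smul, Matrix.vec3_dotProduct, Matrix.vec3_dotProduct, hzg, hzh]
      simp
    by_contra! hne
    refine crossProduct_ne_zero_iff_linearIndependent.2 ?_ hz
    rw [LinearIndependent.pair_iff' hP]
    exact fun c hc => hne c hc.symm

/-- A cubic through three points on each of the lines `g = 0` and `h = 0`, singular at `a`, and
not passing through `P`, the intersection of the lines. -/
theorem exists_singular_cubic {g h : MvPolynomial (Fin 3) ℂ}
    (hg : g.IsHomogeneous 1) (hh : h.IsHomogeneous 1)
    {P : Fin 3 → ℂ} (hP0 : P ≠ 0) (hPg : eval P g = 0) (hPh : eval P h = 0)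
    (x y : Fin 3 → (Fin 3 → ℂ))
    (hxon : ∀ i, eval (x i) g = 0 ∧ eval (x i) h ≠ 0)
    (hyon : ∀ i, eval (y i) h = 0 ∧ eval (y i) g ≠ 0)
    {a : Fin 3 → ℂ} (hag : eval a g ≠ 0) (hah : eval a h ≠ 0) :
    ∃ c : MvPolynomial (Fin 3) ℂ, c.IsHomogeneous 3 ∧ (∀ i, eval (x i) c = 0) ∧
      (∀ i, eval (y i) c = 0) ∧ SingularAt c a ∧ eval P c ≠ 0 := by
  obtain ⟨w, hw, hwa, hwP⟩ : ∃ w : MvPolynomial (Fin 3) ℂ, w.IsHomogeneous 1 ∧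
      eval a w = 0 ∧ eval P w ≠ 0 := by
    obtain ⟨k, hk⟩ := Function.ne_iff.1 hP0
    refine ⟨X k - C (a k / eval a g) * g, (isHomogeneous_X _ _).sub (hg.C_mul _), ?_, ?_⟩
    · simp [hag]
    · simpa [hPg] using hk
  let α : Fin 3 → ℂ := fun i => eval (x i) w / eval (x i) h
  let β : Fin 3 → ℂ := fun i => eval (y i) w / eval (y i) g
  have hα : ∀ i, eval (x i) w = α i * eval (x i) h := fun i => (div_mul_cancel₀ _ (hxon i).2).symm
  have hβ : ∀ i, eval (y i) w = β i * eval (y i) g := fun i => (div_mul_cancel₀ _ (hyon i).2).symm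
  clear_value α β
  obtain ⟨r, s, t, hr, hs, ht⟩ : ∃ r s t : ℂ,
      2 * eval a g * eval a h * r + eval a h ^ 2 * s = 3 * (β 0 * β 1 * β 2) * eval a g ^ 2 ∧
      eval a g ^ 2 * r + 2 * eval a g * eval a h * s = 3 * (α 0 * α 1 * α 2) * eval a h ^ 2 ∧
      (α 0 * α 1 + α 0 * α 2 + α 1 * α 2) * eval a h ^ 2 +
        (β 0 * β 1 + β 0 * β 2 + β 1 * β 2) * eval a g ^ 2 + eval a g * eval a h * t = 0 := by
    generalize eval a g = u at *
    generalize eval a h = v at *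
    refine ⟨(2 * (β 0 * β 1 * β 2) * u ^ 3 - (α 0 * α 1 * α 2) * v ^ 3) / (u ^ 2 * v),
      (2 * (α 0 * α 1 * α 2) * v ^ 3 - (β 0 * β 1 * β 2) * u ^ 3) / (u * v ^ 2),
      -((α 0 * α 1 + α 0 * α 2 + α 1 * α 2) * v ^ 2 +
        (β 0 * β 1 + β 0 * β 2 + β 1 * β 2) * u ^ 2) / (u * v), ?_, ?_, ?_⟩ <;>
    field_simp <;> ring
  refine ⟨(w - C (α 0) * h) * (w - C (α 1) * h) * (w - C (α 2) * h) +
    (w - C (β 0) * g) * (w - C (β 1) * g) * (w - C (β 2) * g) - w * w * w +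
    g * h * (C r * g + C s * h + C t * w), ?_, ?_, ?_, ?_, ?_⟩
  · have H (l : MvPolynomial (Fin 3) ℂ) (hl : l.IsHomogeneous 1) (b : ℂ) :
      (w - C b * l).IsHomogeneous 1 := hw.sub (hl.C_mul b)
    exact (((((H h hh _).mul (H h hh _)).mul (H h hh _)).add
      (((H g hg _).mul (H g hg _)).mul (H g hg _))).sub ((hw.mul hw).mul hw)).add
      ((hg.mul hh).mul (((hg.C_mul r).add (hh.C_mul s)).add (hw.C_mul t)))
  · intro i
    have h0 : (eval (x i) w - α 0 * eval (x i) h) * (eval (x i) w - α 1 * eval (x i) h) *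
        (eval (x i) w - α 2 * eval (x i) h) = 0 := by
      fin_cases i <;> simp [hα]
    simp only [map_add, map_sub, map_mul, eval_C, (hxon i).1]
    linear_combination h0
  · intro i
    have h0 : (eval (y i) w - β 0 * eval (y i) g) * (eval (y i) w - β 1 * eval (y i) g) *
        (eval (y i) w - β 2 * eval (y i) g) = 0 := by
      fin_cases i <;> simp [hβ]
    simp only [map_add, map_sub, map_mul, eval_C, (hyon i).1]
    linear_combination h0
  · intro j
    simp only [map_add, map_sub, Derivation.leibniz, smul_eq_mul, map_mul, eval_C, pderiv_C, hwa,
      map_zero]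
    linear_combination eval a (pderiv j g) * hr + eval a (pderiv j h) * hs +
      eval a (pderiv j w) * ht
  · simpa [hPg, hPh] using hwP

/-- Let `l₁, l₂` be two distinct lines in `ℂP²` (given by non-proportional nonzero linear
forms `g₁, g₂`), let `x₁,x₂,x₃ ∈ l₁ \ l₂` and `y₁,y₂,y₃ ∈ l₂ \ l₁` be distinct points, and
let `A ∉ l₁ ∪ l₂`. Then up to a nonzero scalar there is exactly one cubic passing through
the six points `x_i, y_j` and singular at `A`. -/
theorem stmt_13 (g₁ g₂ : MvPolynomial (Fin 3) ℂ)
    (hg₁0 : g₁ ≠ 0) (hg₁ : g₁.IsHomogeneous 1)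
    (hg₂0 : g₂ ≠ 0) (hg₂ : g₂.IsHomogeneous 1)
    (hlines : ∀ c : ℂ, g₂ ≠ c • g₁)
    (x y : Fin 3 → (Fin 3 → ℂ))
    (hx0 : ∀ i, x i ≠ 0) (hy0 : ∀ i, y i ≠ 0)
    (hxdist : ∀ i j, i ≠ j → ∀ c : ℂ, x i ≠ c • x j)
    (hydist : ∀ i j, i ≠ j → ∀ c : ℂ, y i ≠ c • y j)
    (hxon : ∀ i, MvPolynomial.eval (x i) g₁ = 0 ∧ MvPolynomial.eval (x i) g₂ ≠ 0)
    (hyon : ∀ i, MvPolynomial.eval (y i) g₂ = 0 ∧ MvPolynomial.eval (y i) g₁ ≠ 0)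
    (a : Fin 3 → ℂ) (ha0 : a ≠ 0)
    (haoff : MvPolynomial.eval a g₁ ≠ 0 ∧ MvPolynomial.eval a g₂ ≠ 0) :
    ∃ c : MvPolynomial (Fin 3) ℂ, c ≠ 0 ∧ c.IsHomogeneous 3 ∧
      (∀ i, MvPolynomial.eval (x i) c = 0) ∧ (∀ i, MvPolynomial.eval (y i) c = 0) ∧
      SingularAt c a ∧
      ∀ c' : MvPolynomial (Fin 3) ℂ, c' ≠ 0 → c'.IsHomogeneous 3 →
        (∀ i, MvPolynomial.eval (x i) c' = 0) → (∀ i, MvPolynomial.eval (y i) c' = 0) →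
        SingularAt c' a → ∃ t : ℂ, t ≠ 0 ∧ c' = t • c := by
  obtain ⟨P, hP0, hPg, hPh, hP⟩ := exists_intersection hg₁0 hg₁ hg₂ hlines
  obtain ⟨c, hc, hcx, hcy, hca, hcP⟩ :=
    exists_singular_cubic hg₁ hg₂ hP0 hPg hPh x y hxon hyon haoff.1 haoff.2
  have hc0 : c ≠ 0 := by
    rintro rfl
    exact hcP (map_zero _)
  refine ⟨c, hc0, hc, hcx, hcy, hca, fun c' hc'0 hc' hcx' hcy' hca' => ?_⟩
  have hd : c' - C (eval P c' / eval P c) * c = 0 := by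
    have hdh := hc'.sub (hc.C_mul (eval P c' / eval P c))
    have hdP : eval P (c' - C (eval P c' / eval P c) * c) = 0 := by simp [hcP]
    refine cubic_eq_zero_of_singularAt hdh hg₁ hg₂ hlines haoff.1 haoff.2 (fun j => ?_)
      (fun z => cubic_eq_zero_on_line hdh hg₁ hg₂ hP hdP x hxdist hxon (by simp [hcx, hcx']))
      (fun z => cubic_eq_zero_on_line hdh hg₂ hg₁ (fun z h₂ h₁ => hP z h₁ h₂) hdP y hydist hyon
        (by simp [hcy, hcy']))
    simp [Derivation.leibniz, hca j, hca' j]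
  rw [C_mul', sub_eq_zero] at hd
  refine ⟨eval P c' / eval P c, fun h0 => hc'0 ?_, hd⟩
  rw [hd, h0, zero_smul]
end
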